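/- arXiv:1712.10111 — 6 statements merged into one kernel-verified Lean document; each statement's English description precedes it below -/
import Mathlib

section
/- Let Θ(t) = (θ_1(t),…,θ_N(t)) be a solution of the second-order Kuramoto system m θ_i''(t) + θ_i'(t) = ω_i + (K/N) Σ_{j=1}^N sin(θ_j(t) − θ_i(t)). Then for any indices i, j ∈ {1,…,N} and all t ≥ 0, |θ_i'(t) − θ_j'(t)| ≤ |θ_i'(0) − θ_j'(0)| e^{−t/m} + (|ω_i − ω_j| + 2K)(1 − e^{−t/m}). -/
open Real Filter

/-- A comparison principle for the linear relaxation inequality `m v' + v ≤ C`. -/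
theorem le_of_mul_deriv_add_le {m C : ℝ} (hm : 0 < m) {v v' : ℝ → ℝ}
    (hv : ∀ t, 0 ≤ t → HasDerivAt v (v' t) t) (hC : ∀ t, 0 ≤ t → m * v' t + v t ≤ C)
    {t : ℝ} (ht : 0 ≤ t) :
    v t ≤ v 0 * Real.exp (-t / m) + C * (1 - Real.exp (-t / m)) := by
  have hg : ∀ s, 0 ≤ s → HasDerivAt (fun s ↦ (v s - C) * Real.exp (s / m))
      (v' s * Real.exp (s / m) + (v s - C) * (Real.exp (s / m) * (1 / m))) s := fun s hs ↦
    ((hv s hs).sub_const C).mul ((hasDerivAt_id s).div_const m).exp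
  have hanti : AntitoneOn (fun s ↦ (v s - C) * Real.exp (s / m)) (Set.Ici 0) := by
    refine antitoneOn_of_deriv_nonpos (convex_Ici 0)
      (fun s hs ↦ (hg s hs).continuousAt.continuousWithinAt) (fun s hs ↦ ?_) (fun s hs ↦ ?_)
    · exact (hg s (interior_subset hs)).differentiableAt.differentiableWithinAt
    · have hs' : 0 ≤ s := interior_subset hs
      rw [(hg s hs').deriv]
      have h : v' s * Real.exp (s / m) + (v s - C) * (Real.exp (s / m) * (1 / m))
          = (m * v' s + v s - C) * (Real.exp (s / m) / m) := by
        field_simp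
        ring
      rw [h]
      exact mul_nonpos_of_nonpos_of_nonneg (by linarith [hC s hs']) (by positivity)
  have h := hanti Set.self_mem_Ici ht ht
  simp only [zero_div, Real.exp_zero, mul_one] at h
  have h' := mul_le_mul_of_nonneg_right h (Real.exp_pos (-t / m)).le
  rw [mul_assoc, ← Real.exp_add, neg_div, add_neg_cancel, Real.exp_zero] at h'
  rw [neg_div]
  linarith

/-- Two-sided version of `le_of_mul_deriv_add_le`. -/
theorem abs_le_of_abs_mul_deriv_add_le {m C : ℝ} (hm : 0 < m) {v v' : ℝ → ℝ}
    (hv : ∀ t, 0 ≤ t → HasDerivAt v (v' t) t) (hC : ∀ t, 0 ≤ t → |m * v' t + v t| ≤ C)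
    {t : ℝ} (ht : 0 ≤ t) :
    |v t| ≤ |v 0| * Real.exp (-t / m) + C * (1 - Real.exp (-t / m)) := by
  have hupper := le_of_mul_deriv_add_le hm hv (fun s hs ↦ (abs_le.1 (hC s hs)).2) ht
  have hlower := le_of_mul_deriv_add_le (v := fun s ↦ -v s) (v' := fun s ↦ -v' s) hm
    (fun s hs ↦ (hv s hs).neg) (fun s hs ↦ by linarith [(abs_le.1 (hC s hs)).1]) ht
  have hpos := mul_le_mul_of_nonneg_right (le_abs_self (v 0)) (Real.exp_pos (-t / m)).le
  have hneg := mul_le_mul_of_nonneg_right (neg_le_abs (v 0)) (Real.exp_pos (-t / m)).le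
  exact abs_le.2 ⟨by linarith, by linarith⟩

theorem abs_mean_field_sin_le {N : ℕ} (hN : 0 < N) {K : ℝ} (hK : 0 ≤ K) (x : Fin N → ℝ) :
    |K / N * ∑ j, Real.sin (x j)| ≤ K := by
  have hN' : (0 : ℝ) < N := Nat.cast_pos.2 hN
  have hsum : |∑ j, Real.sin (x j)| ≤ N :=
    (Finset.abs_sum_le_sum_abs _ _).trans <|
      (Finset.sum_le_sum fun j _ ↦ Real.abs_sin_le_one (x j)).trans (by simp)
  calc |K / N * ∑ j, Real.sin (x j)| = K / N * |∑ j, Real.sin (x j)| := by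
        rw [abs_mul, abs_of_nonneg (by positivity)]
    _ ≤ K / N * N := by gcongr
    _ = K := div_mul_cancel₀ K hN'.ne'

/-- Lemma 1.6 (velocity difference estimate) for the second-order Kuramoto
system `m θᵢ'' + θᵢ' = ωᵢ + (K/N) ∑ⱼ sin(θⱼ - θᵢ)`. -/
theorem kuramoto_velocity_difference_estimate
    (N : ℕ) (hN : 0 < N) (m K : ℝ) (hm : 0 < m) (hK : 0 < K)
    (ω : Fin N → ℝ) (θ : Fin N → ℝ → ℝ)
    (hsmooth : ∀ i, ContDiff ℝ 2 (θ i))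
    (hode : ∀ i, ∀ t : ℝ, 0 ≤ t →
      m * deriv (deriv (θ i)) t + deriv (θ i) t
        = ω i + K / N * ∑ j, Real.sin (θ j t - θ i t))
    (i j : Fin N) (t : ℝ) (ht : 0 ≤ t) :
    |deriv (θ i) t - deriv (θ j) t|
      ≤ |deriv (θ i) 0 - deriv (θ j) 0| * Real.exp (-t / m)
        + (|ω i - ω j| + 2 * K) * (1 - Real.exp (-t / m)) := by
  have hd : ∀ k s, HasDerivAt (deriv (θ k)) (deriv (deriv (θ k)) s) s := fun k s ↦
    ((ContDiff.deriv' (n := 1) (by simpa [one_add_one_eq_two] using hsmooth k)).differentiable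
      one_ne_zero s).hasDerivAt
  refine abs_le_of_abs_mul_deriv_add_le (v := fun s ↦ deriv (θ i) s - deriv (θ j) s) hm
    (fun s _ ↦ (hd i s).sub (hd j s)) (fun s hs ↦ ?_) ht
  have hi := abs_le.1 (abs_mean_field_sin_le hN hK.le fun k ↦ θ k s - θ i s)
  have hj := abs_le.1 (abs_mean_field_sin_le hN hK.le fun k ↦ θ k s - θ j s)
  have hω := abs_le.1 (le_refl |ω i - ω j|)
  exact abs_le.2 ⟨by linarith [hode i s hs, hode j s hs], by linarith [hode i s hs, hode j s hs]⟩
end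

section
/- Let Θ(t) = (θ_1(t),…,θ_N(t)) be a solution of the second-order Kuramoto system m θ_i''(t) + θ_i'(t) = ω_i + (K/N) Σ_{j=1}^N sin(θ_j(t) − θ_i(t)). Then for any index i ∈ {1,…,N} and all t ≥ 0, |θ_i'(t)| ≤ |θ_i'(0)| e^{−t/m} + (|ω_i| + K)(1 − e^{−t/m}). -/
open Real Filter

/-- Comparison principle for the linear relaxation inequality `m * deriv v + v ≤ C`. -/
theorem le_of_relaxation_le {m C : ℝ} (hm : 0 < m) {v : ℝ → ℝ} (hv : Differentiable ℝ v)
    (h : ∀ s, 0 ≤ s → m * deriv v s + v s ≤ C) {t : ℝ} (ht : 0 ≤ t) :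
    v t ≤ v 0 * Real.exp (-t / m) + C * (1 - Real.exp (-t / m)) := by
  have hd : ∀ s, HasDerivAt (fun s => (v s - C) * Real.exp (s / m))
      (deriv v s * Real.exp (s / m) + (v s - C) * (Real.exp (s / m) * (1 / m))) s := fun s =>
    ((hv s).hasDerivAt.sub_const C).mul ((hasDerivAt_id s).div_const m).exp
  have hanti : AntitoneOn (fun s => (v s - C) * Real.exp (s / m)) (Set.Ici 0) := by
    refine antitoneOn_of_deriv_nonpos (convex_Ici 0)
      (fun s _ => (hd s).continuousAt.continuousWithinAt)
      (fun s _ => (hd s).differentiableAt.differentiableWithinAt) fun s hs => ?_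
    rw [interior_Ici] at hs
    have heq : deriv v s * Real.exp (s / m) + (v s - C) * (Real.exp (s / m) * (1 / m))
        = (m * deriv v s + v s - C) * (Real.exp (s / m) / m) := by
      field_simp
      ring
    rw [(hd s).deriv, heq]
    exact mul_nonpos_of_nonpos_of_nonneg (sub_nonpos.2 (h s hs.le)) (by positivity)
  have hle : (v t - C) * Real.exp (t / m) ≤ v 0 - C := by
    simpa using hanti Set.self_mem_Ici (Set.mem_Ici.2 ht) ht
  have hmul := mul_le_mul_of_nonneg_right hle (Real.exp_pos (-t / m)).le
  have hexp : Real.exp (t / m) * Real.exp (-t / m) = 1 := by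
    rw [← Real.exp_add, neg_div, add_neg_cancel, Real.exp_zero]
  rw [mul_assoc, hexp] at hmul
  linarith

/-- Two-sided version of `le_of_relaxation_le`. -/
theorem abs_le_of_abs_relaxation_le {m C : ℝ} (hm : 0 < m) {v : ℝ → ℝ} (hv : Differentiable ℝ v)
    (h : ∀ s, 0 ≤ s → |m * deriv v s + v s| ≤ C) {t : ℝ} (ht : 0 ≤ t) :
    |v t| ≤ |v 0| * Real.exp (-t / m) + C * (1 - Real.exp (-t / m)) := by
  have hpos := le_of_relaxation_le hm hv (fun s hs => (abs_le.1 (h s hs)).2) ht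
  have hneg := le_of_relaxation_le (C := C) hm hv.neg (fun s hs => by
    rw [deriv.neg, Pi.neg_apply]
    linarith [(abs_le.1 (h s hs)).1]) ht
  rw [Pi.neg_apply, Pi.neg_apply] at hneg
  have he := (Real.exp_pos (-t / m)).le
  refine abs_le.2 ⟨?_, ?_⟩
  · linarith [mul_le_mul_of_nonneg_right (neg_le_abs (v 0)) he]
  · linarith [mul_le_mul_of_nonneg_right (le_abs_self (v 0)) he]

/-- The mean-field sine coupling of strength `K` is bounded by `K`. -/
theorem abs_mean_sin_le {N : ℕ} {K : ℝ} (hN : 0 < N) (hK : 0 ≤ K) (x : Fin N → ℝ) :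
    |K / N * ∑ j, Real.sin (x j)| ≤ K := by
  have hNpos : (0 : ℝ) < N := Nat.cast_pos.2 hN
  have hsum : |∑ j, Real.sin (x j)| ≤ N := by
    calc |∑ j, Real.sin (x j)| ≤ ∑ j, |Real.sin (x j)| := Finset.abs_sum_le_sum_abs _ _
      _ ≤ ∑ _j : Fin N, (1 : ℝ) := Finset.sum_le_sum fun j _ => Real.abs_sin_le_one _
      _ = N := by simp
  rw [abs_mul, abs_of_nonneg (by positivity : 0 ≤ K / N)]
  calc K / N * |∑ j, Real.sin (x j)| ≤ K / N * N := by gcongr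
    _ = K := div_mul_cancel₀ K (ne_of_gt hNpos)

/-- Lemma 2.3 (single-velocity estimate) for the second-order Kuramoto
system `m θᵢ'' + θᵢ' = ωᵢ + (K/N) ∑ⱼ sin(θⱼ - θᵢ)`. -/
theorem kuramoto_velocity_estimate
    (N : ℕ) (hN : 0 < N) (m K : ℝ) (hm : 0 < m) (hK : 0 < K)
    (ω : Fin N → ℝ) (θ : Fin N → ℝ → ℝ)
    (hsmooth : ∀ i, ContDiff ℝ 2 (θ i))
    (hode : ∀ i, ∀ t : ℝ, 0 ≤ t →
      m * deriv (deriv (θ i)) t + deriv (θ i) t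
        = ω i + K / N * ∑ j, Real.sin (θ j t - θ i t))
    (i : Fin N) (t : ℝ) (ht : 0 ≤ t) :
    |deriv (θ i) t|
      ≤ |deriv (θ i) 0| * Real.exp (-t / m)
        + (|ω i| + K) * (1 - Real.exp (-t / m)) := by
  refine abs_le_of_abs_relaxation_le hm
    ((hsmooth i).differentiable_deriv_two) (fun s hs => ?_) ht
  rw [hode i s hs]
  exact (abs_add_le _ _).trans (by gcongr; exact abs_mean_sin_le hN hK.le _)
end

section
/- Let Θ(t) be a solution of the second-order Kuramoto system m θ_i''(t) + θ_i'(t) = ω_i + (K/N) Σ_{j=1}^N sin(θ_j(t) − θ_i(t)). Define E_N(t) := Σ_{i=1}^N |θ_i'(t)|² and Λ_N(t) := Σ_{i=1}^N ω_i θ_i'(t). Then for every t ≥ 0, (m/2) E_N(t) + ∫₀^t E_N(s) ds = (m/2) E_N(0) + ∫₀^t Λ_N(s) ds + (K/N) Σ_{1 ≤ i < j ≤ N} [cos(θ_j(t) − θ_i(t)) − cos(θ_j(0) − θ_i(0))]. -/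
open Real Filter

/-- A double sum with vanishing diagonal, grouped into unordered pairs. -/
lemma sum_sum_eq_sum_filter_lt {ι M : Type*} [Fintype ι] [LinearOrder ι] [AddCommMonoid M]
    (f : ι → ι → M) (hf : ∀ i, f i i = 0) :
    ∑ i, ∑ j, f i j
      = ∑ p ∈ Finset.univ.filter (fun p : ι × ι => p.1 < p.2), (f p.1 p.2 + f p.2 p.1) := by
  have hsplit : ∀ i j, f i j = (if i < j then f i j else 0) + (if j < i then f i j else 0) := by
    intro i j
    rcases lt_trichotomy i j with h | rfl | h
    · simp [h, h.not_gt]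
    · simp [hf]
    · simp [h, h.not_gt]
  rw [Finset.sum_filter, Fintype.sum_prod_type]
  calc ∑ i, ∑ j, f i j
      = ∑ i, ∑ j, (if i < j then f i j else 0) + ∑ i, ∑ j, (if j < i then f i j else 0) := by
        simp_rw [← Finset.sum_add_distrib, ← hsplit]
    _ = ∑ i, ∑ j, (if i < j then f i j else 0) + ∑ i, ∑ j, (if i < j then f j i else 0) := by
        congr 1
        exact Finset.sum_comm
    _ = ∑ i, ∑ j, (if i < j then f i j + f j i else 0) := by
        simp_rw [← Finset.sum_add_distrib]
        refine Finset.sum_congr rfl fun i _ => Finset.sum_congr rfl fun j _ => ?_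
        split_ifs <;> simp

/-- The power of the coupling forces, written as a sum over unordered pairs. -/
lemma sum_mul_sum_sin_sub {ι : Type*} [Fintype ι] [LinearOrder ι] (x v : ι → ℝ) :
    ∑ i, v i * ∑ j, sin (x j - x i)
      = ∑ p ∈ Finset.univ.filter (fun p : ι × ι => p.1 < p.2),
          -sin (x p.2 - x p.1) * (v p.2 - v p.1) := by
  simp_rw [Finset.mul_sum]
  rw [sum_sum_eq_sum_filter_lt (fun i j => v i * sin (x j - x i)) (by simp)]
  refine Finset.sum_congr rfl fun p _ => ?_
  rw [← neg_sub (x p.2) (x p.1), sin_neg]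
  ring

/-- The energy identity (2.18) for the second-order Kuramoto system:
`(m/2) E_N(t) + ∫₀ᵗ E_N = (m/2) E_N(0) + ∫₀ᵗ Λ_N + (K/N) ∑_{i<j} [cos(θⱼ-θᵢ)]₀ᵗ`. -/
theorem kuramoto_energy_identity
    (N : ℕ) (hN : 0 < N) (m K : ℝ) (hm : 0 < m) (hK : 0 < K)
    (ω : Fin N → ℝ) (θ : Fin N → ℝ → ℝ)
    (hsmooth : ∀ i, ContDiff ℝ 2 (θ i))
    (hode : ∀ i, ∀ t : ℝ, 0 ≤ t →
      m * deriv (deriv (θ i)) t + deriv (θ i) t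
        = ω i + K / N * ∑ j, Real.sin (θ j t - θ i t))
    (t : ℝ) (ht : 0 ≤ t) :
    m / 2 * (∑ i, (deriv (θ i) t) ^ 2)
      + ∫ s in (0:ℝ)..t, ∑ i, (deriv (θ i) s) ^ 2
    = m / 2 * (∑ i, (deriv (θ i) 0) ^ 2)
      + (∫ s in (0:ℝ)..t, ∑ i, ω i * deriv (θ i) s)
      + K / N * ∑ p ∈ Finset.univ.filter (fun p : Fin N × Fin N => p.1 < p.2),
          (Real.cos (θ p.2 t - θ p.1 t) - Real.cos (θ p.2 0 - θ p.1 0)) := by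
  have hθ : ∀ i s, HasDerivAt (θ i) (deriv (θ i) s) s := fun i s =>
    ((hsmooth i).differentiable (by norm_num) s).hasDerivAt
  have hsmooth' : ∀ i, ContDiff ℝ 1 (deriv (θ i)) := fun i =>
    ((contDiff_succ_iff_deriv (n := 1)).1 (by simpa [one_add_one_eq_two] using hsmooth i)).2.2
  have hv : ∀ i s, HasDerivAt (deriv (θ i)) (deriv (deriv (θ i)) s) s := fun i s =>
    ((hsmooth' i).differentiable (by norm_num) s).hasDerivAt
  have hvc : ∀ i, Continuous (deriv (θ i)) := fun i => (hsmooth' i).continuous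
  have hE : Continuous fun s => ∑ i, (deriv (θ i) s) ^ 2 := by fun_prop
  have hΛ : Continuous fun s => ∑ i, ω i * deriv (θ i) s := by fun_prop
  set P := Finset.univ.filter (fun p : Fin N × Fin N => p.1 < p.2)
  have hF : ∀ s ∈ Set.uIcc 0 t, HasDerivAt
      (fun s => m / 2 * (∑ i, (deriv (θ i) s) ^ 2)
        - K / N * ∑ p ∈ P, cos (θ p.2 s - θ p.1 s))
      ((∑ i, ω i * deriv (θ i) s) - ∑ i, (deriv (θ i) s) ^ 2) s := by
    intro s hs
    rw [Set.uIcc_of_le ht] at hs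
    have hkin := (HasDerivAt.fun_sum (u := Finset.univ)
      fun i _ => (hv i s).fun_pow 2).const_mul (m / 2)
    have hpot := (HasDerivAt.fun_sum (u := P)
      fun p _ => ((hθ p.2 s).fun_sub (hθ p.1 s)).cos).const_mul (K / N : ℝ)
    refine (hkin.fun_sub hpot).congr_deriv ?_
    rw [← sum_mul_sum_sin_sub (fun i => θ i s) (fun i => deriv (θ i) s), Finset.mul_sum,
      Finset.mul_sum, ← Finset.sum_sub_distrib, ← Finset.sum_sub_distrib]
    refine Finset.sum_congr rfl fun i _ => ?_
    push_cast
    linear_combination deriv (θ i) s * hode i s hs.1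
  have hint := intervalIntegral.integral_eq_sub_of_hasDerivAt hF
    ((hΛ.sub hE).intervalIntegrable 0 t)
  rw [intervalIntegral.integral_sub (hΛ.intervalIntegrable 0 t)
    (hE.intervalIntegrable 0 t)] at hint
  rw [Finset.sum_sub_distrib]
  linear_combination -hint
end

section
/- Assume the mean-zero frequency condition Σ_{i=1}^N ω_i = 0, and let Θ(t) be a solution of the second-order Kuramoto system m θ_i''(t) + θ_i'(t) = ω_i + (K/N) Σ_{j=1}^N sin(θ_j(t) − θ_i(t)). If there exists M > 0 such that sup_{t≥0} |∫₀^t Σ_{i=1}^N ω_i θ_i'(s) ds| < M, then lim_{t→∞} θ_i'(t) = 0 for every i = 1,…,N. -/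
open Real Filter

/-- If `E` is bounded below and decreases at least at rate `v ^ 2` along `[0, ∞)`, and `v` has
bounded derivative there, then `v` tends to zero. -/
theorem tendsto_zero_of_hasDerivAt_le_neg_sq {E E' v v' : ℝ → ℝ} {B C : ℝ}
    (hE : ∀ t, 0 ≤ t → HasDerivAt E (E' t) t)
    (hE' : ∀ t, 0 ≤ t → E' t ≤ -(v t) ^ 2)
    (hB : ∀ t, 0 ≤ t → B ≤ E t)
    (hv : ∀ t, 0 ≤ t → HasDerivAt v (v' t) t)
    (hC : ∀ t, 0 ≤ t → |v' t| ≤ C) :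
    Tendsto v atTop (nhds 0) := by
  have decay : ∀ c, 0 ≤ c → ∀ s t, 0 ≤ s → s ≤ t → (∀ r, s ≤ r → r ≤ t → c ≤ v r ^ 2) →
      E t - E s ≤ -c * (t - s) := by
    intro c _ s t hs hst hc
    refine (convex_Icc s t).image_sub_le_mul_sub_of_deriv_le
      (fun r hr => (hE r (hs.trans hr.1)).continuousAt.continuousWithinAt)
      (fun r hr => ?_) (fun r hr => ?_) s ⟨le_rfl, hst⟩ t ⟨hst, le_rfl⟩ hst
    · have hr' := interior_subset hr
      exact (hE r (hs.trans hr'.1)).differentiableAt.differentiableWithinAt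
    · have hr' := interior_subset hr
      rw [(hE r (hs.trans hr'.1)).deriv]
      linarith [hE' r (hs.trans hr'.1), hc r hr'.1 hr'.2]
  have lip : ∀ s t, 0 ≤ s → s ≤ t → |v t - v s| ≤ C * (t - s) := by
    intro s t hs hst
    have h := (convex_Icc s t).norm_image_sub_le_of_norm_hasDerivWithin_le
      (fun r hr => (hv r (hs.trans hr.1)).hasDerivWithinAt)
      (fun r hr => hC r (hs.trans hr.1)) ⟨le_rfl, hst⟩ ⟨hst, le_rfl⟩
    rwa [Real.norm_eq_abs, Real.norm_eq_abs, abs_of_nonneg (sub_nonneg.2 hst)] at h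
  have anti : Antitone fun t => E (max t 0) := by
    intro s t hst
    have h := decay 0 le_rfl (max s 0) (max t 0) (le_max_right _ _)
      (max_le_max_right 0 hst) (fun r _ _ => sq_nonneg _)
    simp only
    linarith
  have lim := tendsto_atTop_ciInf anti ⟨B, by rintro _ ⟨t, rfl⟩; exact hB _ (le_max_right _ _)⟩
  have hC0 : 0 ≤ C := (abs_nonneg _).trans (hC 0 le_rfl)
  rw [Metric.tendsto_atTop']
  intro ε hε
  set δ := ε / (2 * (C + 1)) with hδ
  have hδ0 : 0 < δ := by positivity
  have hCδ : C * δ ≤ ε / 2 := by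
    rw [hδ, mul_div_assoc', div_le_div_iff₀ (by positivity) (by positivity)]
    nlinarith
  have diff := (lim.comp (tendsto_atTop_add_const_right atTop δ tendsto_id)).sub lim
  rw [sub_self] at diff
  have small := diff.eventually (lt_mem_nhds (show -((ε / 2) ^ 2 * δ) < 0 by
    have : 0 < (ε / 2) ^ 2 * δ := by positivity
    linarith))
  obtain ⟨T, hT⟩ := eventually_atTop.1 small
  refine ⟨max T 0, fun t ht => ?_⟩
  have ht0 : 0 ≤ t := (le_max_right _ _).trans ht.le
  have h := hT t ((le_max_left _ _).trans ht.le)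
  simp only [Function.comp_apply, id_eq, max_eq_left ht0,
    max_eq_left (add_nonneg ht0 hδ0.le)] at h
  rw [dist_zero_right, Real.norm_eq_abs]
  by_contra! hge
  have hdecay := decay ((ε / 2) ^ 2) (sq_nonneg _) t (t + δ) ht0 (by linarith) (by
    intro r hr hr'
    rw [← sq_abs (v r)]
    have h1 := lip t r ht0 hr
    have h2 : C * (r - t) ≤ C * δ := mul_le_mul_of_nonneg_left (by linarith) hC0
    have h3 := abs_sub_abs_le_abs_sub (v t) (v r)
    rw [abs_sub_comm] at h3
    exact pow_le_pow_left₀ (by positivity) (by linarith) 2)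
  linarith

/-- Antisymmetry of the sine turns the coupling power into a single weighted sum. -/
theorem sum_sum_sin_sub_mul_sub {ι : Type*} [Fintype ι] (x v : ι → ℝ) :
    ∑ i, ∑ j, sin (x j - x i) * (v j - v i) = -2 * ∑ i, v i * ∑ j, sin (x j - x i) := by
  have h : ∑ i, ∑ j, sin (x j - x i) * v j = -∑ i, ∑ j, sin (x j - x i) * v i := by
    rw [Finset.sum_comm, ← Finset.sum_neg_distrib]
    refine Finset.sum_congr rfl fun i _ => ?_
    rw [← Finset.sum_neg_distrib]
    refine Finset.sum_congr rfl fun j _ => ?_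
    rw [← neg_sub (x j), sin_neg, neg_mul]
  have h' : ∑ i, v i * ∑ j, sin (x j - x i) = ∑ i, ∑ j, sin (x j - x i) * v i := by
    simp_rw [Finset.mul_sum, mul_comm]
  simp_rw [mul_sub, Finset.sum_sub_distrib]
  rw [h, h']
  ring

/-- Lemma 2.5: if the work term `∫₀ᵗ Λ_N(s) ds` is uniformly bounded, then the
second-order Kuramoto system (with mean-zero frequencies) frequency-synchronizes
to zero. -/
theorem kuramoto_bounded_work_implies_sync
    (N : ℕ) (hN : 0 < N) (m K : ℝ) (hm : 0 < m) (hK : 0 < K)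
    (ω : Fin N → ℝ) (hmean : ∑ i, ω i = 0)
    (θ : Fin N → ℝ → ℝ)
    (hsmooth : ∀ i, ContDiff ℝ 2 (θ i))
    (hode : ∀ i, ∀ t : ℝ, 0 ≤ t →
      m * deriv (deriv (θ i)) t + deriv (θ i) t
        = ω i + K / N * ∑ j, Real.sin (θ j t - θ i t))
    (hwork : ∃ M : ℝ, 0 < M ∧ ∀ t : ℝ, 0 ≤ t →
      |∫ s in (0:ℝ)..t, ∑ i, ω i * deriv (θ i) s| < M) :
    ∀ i, Tendsto (deriv (θ i)) atTop (nhds 0) := by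
  obtain ⟨M, -, hM⟩ := hwork
  have hN' : (0 : ℝ) < N := by exact_mod_cast hN
  have hx : ∀ i t, HasDerivAt (θ i) (deriv (θ i) t) t := fun i t =>
    ((hsmooth i).differentiable (by norm_num) t).hasDerivAt
  have hsmooth' : ∀ i, ContDiff ℝ 1 (deriv (θ i)) := fun i => (hsmooth i).deriv'
  have hv : ∀ i t, HasDerivAt (deriv (θ i)) (deriv (deriv (θ i)) t) t := fun i t =>
    ((hsmooth' i).differentiable (by norm_num) t).hasDerivAt
  have hcont : Continuous fun s => ∑ i, ω i * deriv (θ i) s :=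
    continuous_finsetSum _ fun i _ => continuous_const.mul (hsmooth' i).continuous
  set E : ℝ → ℝ := fun t => m / 2 * ∑ i, deriv (θ i) t ^ 2
    - K / (2 * N) * ∑ i, ∑ j, cos (θ j t - θ i t)
    - ∫ s in (0:ℝ)..t, ∑ i, ω i * deriv (θ i) s with hEdef
  have hE : ∀ t, 0 ≤ t → HasDerivAt E (-∑ i, deriv (θ i) t ^ 2) t := by
    intro t ht
    have h1 : HasDerivAt (fun t => ∑ i, deriv (θ i) t ^ 2)
        (∑ i, 2 * deriv (θ i) t * deriv (deriv (θ i)) t) t :=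
      HasDerivAt.fun_sum fun i _ => by simpa using (hv i t).fun_pow 2
    have h2 : HasDerivAt (fun t => ∑ i, ∑ j, cos (θ j t - θ i t))
        (∑ i, ∑ j, -sin (θ j t - θ i t) * (deriv (θ j) t - deriv (θ i) t)) t :=
      HasDerivAt.fun_sum fun i _ => HasDerivAt.fun_sum fun j _ => ((hx j t).sub (hx i t)).cos
    have h3 := (hcont.integral_hasStrictDerivAt 0 t).hasDerivAt
    refine (((h1.const_mul (m / 2)).sub (h2.const_mul (K / (2 * N)))).sub h3).congr_deriv ?_
    simp_rw [neg_mul, Finset.sum_neg_distrib]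
    rw [sum_sum_sin_sub_mul_sub (fun i => θ i t) fun i => deriv (θ i) t]
    have hK2 : ∀ S : ℝ, K / (2 * N) * -(-2 * S) = K / N * S := fun S => by field_simp
    rw [hK2, Finset.mul_sum, Finset.mul_sum, ← Finset.sum_sub_distrib, ← Finset.sum_sub_distrib,
      ← Finset.sum_neg_distrib]
    refine Finset.sum_congr rfl fun i _ => ?_
    linear_combination deriv (θ i) t * hode i t ht
  have hcos : ∀ t, ∑ i, ∑ j, cos (θ j t - θ i t) ≤ (N : ℝ) * N := by
    intro t
    calc ∑ i, ∑ j, cos (θ j t - θ i t) ≤ ∑ _i : Fin N, ∑ _j : Fin N, (1 : ℝ) :=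
          Finset.sum_le_sum fun i _ => Finset.sum_le_sum fun j _ => cos_le_one _
      _ = N * N := by simp
  have hlower : ∀ t, 0 ≤ t →
      m / 2 * ∑ i, deriv (θ i) t ^ 2 - (K / (2 * N) * (N * N) + M) ≤ E t := by
    intro t ht
    have h1 := mul_le_mul_of_nonneg_left (hcos t) (show 0 ≤ K / (2 * N) by positivity)
    have h2 := (abs_lt.1 (hM t ht)).2
    simp only [hEdef]
    linarith
  have hanti : ∀ t, 0 ≤ t → E t ≤ E 0 := by
    intro t ht
    refine antitoneOn_of_deriv_nonpos (convex_Ici 0)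
      (fun r hr => (hE r hr).continuousAt.continuousWithinAt)
      (fun r hr => (hE r (interior_subset hr)).differentiableAt.differentiableWithinAt)
      (fun r hr => ?_) (Set.mem_Ici.2 le_rfl) ht ht
    rw [(hE r (interior_subset hr)).deriv]
    exact neg_nonpos.2 (Finset.sum_nonneg fun i _ => sq_nonneg _)
  have hle : ∀ i t, deriv (θ i) t ^ 2 ≤ ∑ j, deriv (θ j) t ^ 2 := fun i t =>
    Finset.single_le_sum (f := fun j => deriv (θ j) t ^ 2) (fun j _ => sq_nonneg _)
      (Finset.mem_univ i)
  set Q := (E 0 + (K / (2 * N) * (N * N) + M)) / (m / 2) with hQ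
  have hvb : ∀ i t, 0 ≤ t → |deriv (θ i) t| ≤ √Q := by
    intro i t ht
    apply abs_le_sqrt
    refine (hle i t).trans ?_
    rw [hQ, le_div_iff₀ (by positivity)]
    linarith [hlower t ht, hanti t ht]
  intro i
  refine tendsto_zero_of_hasDerivAt_le_neg_sq (B := -(K / (2 * N) * (N * N) + M))
    (C := (|ω i| + K / N * N + √Q) / m) hE
    (fun t _ => neg_le_neg (hle i t)) (fun t ht => ?_) (fun t _ => hv i t) (fun t ht => ?_)
  · have h1 : 0 ≤ m / 2 * ∑ i, deriv (θ i) t ^ 2 :=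
      mul_nonneg (by positivity) (Finset.sum_nonneg fun i _ => sq_nonneg _)
    linarith [hlower t ht]
  · have hsin : |∑ j, sin (θ j t - θ i t)| ≤ N := by
      calc |∑ j, sin (θ j t - θ i t)| ≤ ∑ j, |sin (θ j t - θ i t)| :=
            Finset.abs_sum_le_sum_abs _ _
        _ ≤ ∑ _j : Fin N, (1 : ℝ) := Finset.sum_le_sum fun j _ => abs_sin_le_one _
        _ = N := by simp
    have hcoup : |K / N * ∑ j, sin (θ j t - θ i t)| ≤ K / N * N := by
      rw [abs_mul, abs_of_pos (show 0 < K / N by positivity)]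
      exact mul_le_mul_of_nonneg_left hsin (by positivity)
    rw [le_div_iff₀ hm, ← abs_of_pos hm, ← abs_mul]
    have heq : deriv (deriv (θ i)) t * m
        = ω i + K / N * ∑ j, sin (θ j t - θ i t) - deriv (θ i) t := by
      linarith [hode i t ht]
    rw [heq]
    exact (abs_sub _ _).trans (add_le_add ((abs_add_le _ _).trans (by gcongr)) (hvb i t ht))
end

section
/- Assume the mean-zero frequency condition Σ_{i=1}^N ω_i = 0, and let Θ(t) be a solution of the second-order Kuramoto system m θ_i''(t) + θ_i'(t) = ω_i + (K/N) Σ_{j=1}^N sin(θ_j(t) − θ_i(t)). If the diameter function is uniformly bounded, i.e. sup_{t≥0} D(Θ(t)) < ∞, then lim_{t→∞} θ_i'(t) = 0 for every i = 1,…,N. -/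
open Real Filter

/-- The diameter `D(X) = max_{i≠j} (xᵢ - xⱼ)` of a vector `X ∈ ℝ^N`
(realized as the supremum of `xᵢ - xⱼ` over all pairs). -/
noncomputable def diam {n : ℕ} (X : Fin n → ℝ) : ℝ :=
  ⨆ p : Fin n × Fin n, (X p.1 - X p.2)

/-- Barbalat's lemma: if `f` converges at infinity and its derivative `g` has a bounded derivative,
then `g` tends to zero. -/
theorem tendsto_deriv_zero_of_tendsto_of_bounded_deriv {f g g' : ℝ → ℝ} {L l : ℝ}
    (hf : ∀ t, 0 ≤ t → HasDerivAt f (g t) t) (hg : ∀ t, 0 ≤ t → HasDerivAt g (g' t) t)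
    (hL : ∀ t, 0 ≤ t → |g' t| ≤ L) (hlim : Tendsto f atTop (nhds l)) :
    Tendsto g atTop (nhds 0) := by
  have hL0 : 0 ≤ L := (abs_nonneg _).trans (hL 0 le_rfl)
  have hlip : ∀ s t, 0 ≤ s → 0 ≤ t → |g t - g s| ≤ L * |t - s| := fun s t hs ht =>
    (convex_Ici (0 : ℝ)).norm_image_sub_le_of_norm_hasDerivWithin_le
      (fun x hx => (hg x hx).hasDerivWithinAt) (fun x hx => hL x hx) hs ht
  rw [Metric.tendsto_atTop]
  intro ε hε
  set h : ℝ := ε / (2 * (L + 1)) with hh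
  have hpos : 0 < h := by positivity
  have hLh : (L + 1) * h = ε / 2 := by rw [hh]; field_simp
  obtain ⟨T, hT⟩ := Metric.tendsto_atTop.1 hlim (h * ε / 4) (by positivity)
  refine ⟨max T 0, fun t ht => ?_⟩
  have hT' : T ≤ t := (le_max_left _ _).trans ht
  have ht0 : 0 ≤ t := (le_max_right _ _).trans ht
  obtain ⟨c, ⟨hc1, hc2⟩, hc⟩ := exists_hasDerivAt_eq_slope f g (show t < t + h by linarith)
    (fun x hx => (hf x (ht0.trans hx.1)).continuousAt.continuousWithinAt)
    (fun x hx => hf x (ht0.trans hx.1.le))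
  have h1 := hT t hT'
  have h2 := hT (t + h) (by linarith)
  rw [Real.dist_eq, abs_lt] at h1 h2
  have h3 := hlip t c ht0 (by linarith)
  rw [abs_of_pos (show 0 < c - t by linarith)] at h3
  have h4 : L * (c - t) ≤ L * h := mul_le_mul_of_nonneg_left (by linarith) hL0
  have hc' : g c * h = f (t + h) - f t := by
    rw [hc, add_sub_cancel_left, div_mul_cancel₀ _ hpos.ne']
  have h5 := abs_le.1 (h3.trans h4)
  have h6 : g c < ε / 2 := by
    by_contra! hcon
    nlinarith [mul_le_mul_of_nonneg_right hcon hpos.le]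
  have h7 : -(ε / 2) < g c := by
    by_contra! hcon
    nlinarith [mul_le_mul_of_nonneg_right hcon hpos.le]
  rw [Real.dist_eq, sub_zero, abs_lt]
  constructor <;> nlinarith

theorem sub_le_diam {n : ℕ} (X : Fin n → ℝ) (i j : Fin n) : X i - X j ≤ diam X :=
  le_ciSup (f := fun p : Fin n × Fin n => X p.1 - X p.2) (Set.finite_range _).bddAbove (i, j)

/-- The linear potential of mean-zero weights is controlled by the diameter. -/
theorem sum_mul_le_sum_abs_mul_diam {n : ℕ} (ω X : Fin n → ℝ) (hω : ∑ i, ω i = 0) :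
    ∑ i, ω i * X i ≤ (∑ i, |ω i|) * diam X := by
  rcases Nat.eq_zero_or_pos n with rfl | hn
  · simp
  let z : Fin n := ⟨0, hn⟩
  calc ∑ i, ω i * X i = ∑ i, ω i * (X i - X z) := by
        simp only [mul_sub, Finset.sum_sub_distrib, ← Finset.sum_mul, hω, zero_mul, sub_zero]
    _ ≤ ∑ i, |ω i| * diam X := Finset.sum_le_sum fun i _ => by
        refine (le_abs_self _).trans ?_
        rw [abs_mul]
        refine mul_le_mul_of_nonneg_left (abs_le.2 ⟨?_, sub_le_diam X i z⟩) (abs_nonneg _)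
        linarith [sub_le_diam X z i]
    _ = _ := by rw [Finset.sum_mul]

theorem sum_sum_sin_mul_sub {n : ℕ} (X v : Fin n → ℝ) :
    ∑ i, ∑ j, sin (X j - X i) * (v j - v i) = -2 * ∑ i, v i * ∑ j, sin (X j - X i) := by
  have h1 : ∑ i, ∑ j, sin (X j - X i) * v j = -∑ i, v i * ∑ j, sin (X j - X i) := by
    rw [Finset.sum_comm, ← Finset.sum_neg_distrib]
    refine Finset.sum_congr rfl fun i _ => ?_
    rw [Finset.mul_sum, ← Finset.sum_neg_distrib]
    refine Finset.sum_congr rfl fun j _ => ?_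
    rw [← neg_sub (X j) (X i), sin_neg]
    ring
  have h2 : ∑ i, ∑ j, sin (X j - X i) * v i = ∑ i, v i * ∑ j, sin (X j - X i) := by
    simp only [Finset.mul_sum, mul_comm]
  simp only [mul_sub, Finset.sum_sub_distrib, h1, h2]
  ring

/-- The total energy of the second-order Kuramoto system at positions `X` and velocities `v`. -/
noncomputable def kuramotoEnergy {n : ℕ} (m K : ℝ) (ω X v : Fin n → ℝ) : ℝ :=
  m / 2 * ∑ i, v i ^ 2 + K / (2 * n) * ∑ i, ∑ j, (1 - cos (X j - X i)) - ∑ i, ω i * X i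

theorem hasDerivAt_kuramotoEnergy {n : ℕ} {m K : ℝ} {ω : Fin n → ℝ} {θ v a : Fin n → ℝ → ℝ} {t : ℝ}
    (hθ : ∀ i, HasDerivAt (θ i) (v i t) t) (hv : ∀ i, HasDerivAt (v i) (a i t) t)
    (hode : ∀ i, m * a i t + v i t = ω i + K / n * ∑ j, sin (θ j t - θ i t)) :
    HasDerivAt (fun s => kuramotoEnergy m K ω (fun i => θ i s) (fun i => v i s))
      (-∑ i, v i t ^ 2) t := by
  have h1 : HasDerivAt (fun s => ∑ i, v i s ^ 2) (∑ i, 2 * v i t * a i t) t :=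
    HasDerivAt.fun_sum fun i _ => by simpa using (hv i).fun_pow 2
  have h2 : HasDerivAt (fun s => ∑ i, ∑ j, (1 - cos (θ j s - θ i s)))
      (∑ i, ∑ j, sin (θ j t - θ i t) * (v j t - v i t)) t :=
    HasDerivAt.fun_sum fun i _ => HasDerivAt.fun_sum fun j _ => by
      simpa using ((hθ j).fun_sub (hθ i)).cos.const_sub 1
  have h3 : HasDerivAt (fun s => ∑ i, ω i * θ i s) (∑ i, ω i * v i t) t :=
    HasDerivAt.fun_sum fun i _ => (hθ i).const_mul (ω i)
  refine (((h1.const_mul (m / 2)).fun_add (h2.const_mul (K / (2 * n)))).fun_sub h3).congr_deriv ?_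
  rw [sum_sum_sin_mul_sub (fun i => θ i t) (fun i => v i t)]
  have h4 : ∑ i, v i t * (m * a i t + v i t) =
      ∑ i, v i t * (ω i + K / n * ∑ j, sin (θ j t - θ i t)) :=
    Finset.sum_congr rfl fun i _ => by rw [hode i]
  have h5 : ∑ i, v i t * (m * a i t + v i t) =
      m / 2 * ∑ i, 2 * v i t * a i t + ∑ i, v i t ^ 2 := by
    rw [Finset.mul_sum, ← Finset.sum_add_distrib]
    exact Finset.sum_congr rfl fun i _ => by ring
  have h6 : ∑ i, v i t * (ω i + K / n * ∑ j, sin (θ j t - θ i t)) =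
      ∑ i, ω i * v i t + K / n * ∑ i, v i t * ∑ j, sin (θ j t - θ i t) := by
    rw [Finset.mul_sum, ← Finset.sum_add_distrib]
    exact Finset.sum_congr rfl fun i _ => by ring
  have h7 : K / (2 * n) * (-2 * ∑ i, v i t * ∑ j, sin (θ j t - θ i t)) =
      -(K / n * ∑ i, v i t * ∑ j, sin (θ j t - θ i t)) := by
    rw [mul_comm (2 : ℝ), ← div_div]
    ring
  linarith

theorem kinetic_le_kuramotoEnergy {n : ℕ} {m K : ℝ} (hK : 0 ≤ K) {ω : Fin n → ℝ}
    (hω : ∑ i, ω i = 0) (X v : Fin n → ℝ) :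
    m / 2 * ∑ i, v i ^ 2 ≤ kuramotoEnergy m K ω X v + (∑ i, |ω i|) * diam X := by
  have h1 := sum_mul_le_sum_abs_mul_diam ω X hω
  have h2 : 0 ≤ K / (2 * n) * ∑ i, ∑ j, (1 - cos (X j - X i)) :=
    mul_nonneg (by positivity) <| Finset.sum_nonneg fun i _ => Finset.sum_nonneg fun j _ =>
      sub_nonneg.2 (cos_le_one _)
  unfold kuramotoEnergy
  linarith

/-- The coupling force on a single oscillator is at most `K`. -/
theorem abs_coupling_le {n : ℕ} {K : ℝ} (hK : 0 ≤ K) (X : Fin n → ℝ) (i : Fin n) :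
    |K / n * ∑ j, sin (X j - X i)| ≤ K := by
  have hn : (0 : ℝ) < n := Nat.cast_pos.2 i.pos
  have h : |∑ j, sin (X j - X i)| ≤ n := by
    refine (Finset.abs_sum_le_sum_abs _ _).trans ?_
    refine (Finset.sum_le_sum fun j _ => abs_sin_le_one (X j - X i)).trans ?_
    simp
  rw [abs_mul, abs_of_nonneg (by positivity)]
  calc K / n * |∑ j, sin (X j - X i)| ≤ K / n * n := by gcongr
    _ = K := div_mul_cancel₀ _ (ne_of_gt hn)

/-- Lemma 2.6: under the mean-zero frequency condition, uniform boundedness of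
the diameter function `D(Θ(t))` implies complete frequency synchronization. -/
theorem kuramoto_bounded_diameter_implies_sync
    (N : ℕ) (hN : 0 < N) (m K : ℝ) (hm : 0 < m) (hK : 0 < K)
    (ω : Fin N → ℝ) (hmean : ∑ i, ω i = 0)
    (θ : Fin N → ℝ → ℝ)
    (hsmooth : ∀ i, ContDiff ℝ 2 (θ i))
    (hode : ∀ i, ∀ t : ℝ, 0 ≤ t →
      m * deriv (deriv (θ i)) t + deriv (θ i) t
        = ω i + K / N * ∑ j, Real.sin (θ j t - θ i t))
    (hdiam : ∃ C : ℝ, ∀ t : ℝ, 0 ≤ t → diam (fun i => θ i t) ≤ C) :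
    ∀ i, Tendsto (deriv (θ i)) atTop (nhds 0) := by
  obtain ⟨C, hC⟩ := hdiam
  set v : Fin N → ℝ → ℝ := fun i => deriv (θ i)
  set a : Fin N → ℝ → ℝ := fun i => deriv (deriv (θ i))
  have hθ : ∀ i t, HasDerivAt (θ i) (v i t) t := fun i t =>
    ((hsmooth i).differentiable (by norm_num) t).hasDerivAt
  have hv : ∀ i t, HasDerivAt (v i) (a i t) t := fun i t =>
    ((hsmooth i).differentiable_deriv_two t).hasDerivAt
  set E : ℝ → ℝ := fun t => kuramotoEnergy m K ω (fun i => θ i t) (fun i => v i t)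
  set F : ℝ → ℝ := fun t => ∑ i, v i t ^ 2
  have hE : ∀ t, 0 ≤ t → HasDerivAt E (-F t) t := fun t ht =>
    hasDerivAt_kuramotoEnergy (fun i => hθ i t) (fun i => hv i t) (fun i => hode i t ht)
  have hF0 : ∀ t, 0 ≤ F t := fun t => Finset.sum_nonneg fun i _ => sq_nonneg _
  set W : ℝ := (∑ i, |ω i|) * C
  have hkin : ∀ t, 0 ≤ t → m / 2 * F t ≤ E t + W := fun t ht =>
    (kinetic_le_kuramotoEnergy hK.le hmean _ _).trans <|
      add_le_add_right (mul_le_mul_of_nonneg_left (hC t ht)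
        (Finset.sum_nonneg fun i _ => abs_nonneg _)) _
  have hanti : AntitoneOn E (Set.Ici 0) := by
    refine antitoneOn_of_hasDerivWithinAt_nonpos (convex_Ici 0)
      (fun t ht => (hE t ht).continuousAt.continuousWithinAt)
      (fun t ht => (hE t (interior_subset ht)).hasDerivWithinAt)
      (fun t _ => neg_nonpos.2 (hF0 t))
  obtain ⟨l, hl⟩ : ∃ l, Tendsto E atTop (nhds l) := by
    have hA : Antitone fun t => E (max t 0) := fun s t hst =>
      hanti (Set.mem_Ici.2 (le_max_right _ _)) (Set.mem_Ici.2 (le_max_right _ _)) (max_le_max_right 0 hst)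
    have hB : BddBelow (Set.range fun t => E (max t 0)) := by
      refine ⟨-W, ?_⟩
      rintro _ ⟨t, rfl⟩
      have h1 := hkin (max t 0) (le_max_right _ _)
      have h2 := mul_nonneg (half_pos hm).le (hF0 (max t 0))
      show -W ≤ E (max t 0)
      linarith
    refine ⟨_, (tendsto_atTop_ciInf hA hB).congr' ?_⟩
    filter_upwards [eventually_ge_atTop 0] with t ht
    rw [max_eq_left ht]
  set B : ℝ := (E 0 + W) / (m / 2) with hB
  have hFB : ∀ t, 0 ≤ t → F t ≤ B := fun t ht => by
    rw [hB, le_div_iff₀' (half_pos hm)]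
    linarith [hkin t ht, hanti Set.self_mem_Ici ht ht]
  have hvF : ∀ i t, v i t ^ 2 ≤ F t := fun i t =>
    Finset.single_le_sum (f := fun i => v i t ^ 2) (fun i _ => sq_nonneg _) (Finset.mem_univ i)
  have hvB : ∀ i t, 0 ≤ t → |v i t| ≤ √B := fun i t ht =>
    abs_le_sqrt ((hvF i t).trans (hFB t ht))
  have haB : ∀ i t, 0 ≤ t → |a i t| ≤ (|ω i| + K + √B) / m := fun i t ht => by
    rw [le_div_iff₀' hm, show m * |a i t| = |m * a i t| by rw [abs_mul, abs_of_pos hm],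
      eq_sub_of_add_eq (hode i t ht)]
    refine (abs_sub _ _).trans (add_le_add ((abs_add_le _ _).trans ?_) (hvB i t ht))
    exact add_le_add_right (abs_coupling_le hK.le (fun j => θ j t) i) _
  have hF : ∀ t, HasDerivAt F (∑ i, 2 * v i t * a i t) t := fun t =>
    HasDerivAt.fun_sum fun i _ => by simpa using (hv i t).fun_pow 2
  have hF' : ∀ t, 0 ≤ t →
      |-∑ i, 2 * v i t * a i t| ≤ ∑ i, 2 * √B * ((|ω i| + K + √B) / m) := fun t ht => by
    rw [abs_neg]
    refine (Finset.abs_sum_le_sum_abs _ _).trans (Finset.sum_le_sum fun i _ => ?_)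
    rw [abs_mul, abs_mul, abs_two]
    have h1 := hvB i t ht
    have h2 := haB i t ht
    gcongr
  have hlim : Tendsto F atTop (nhds 0) := by
    simpa using (tendsto_deriv_zero_of_tendsto_of_bounded_deriv hE
      (fun t _ => (hF t).fun_neg) hF' hl).neg
  intro i
  refine squeeze_zero_norm (fun t => abs_le_sqrt (hvF i t)) ?_
  simpa using hlim.sqrt
end

section
/- Let Θ(t) = (θ_1(t),…,θ_N(t)) be a solution of the second-order Kuramoto system m θ_i''(t) + θ_i'(t) = ω_i + (K/N) Σ_{j=1}^N sin(θ_j(t) − θ_i(t)). Then for any indices i, j ∈ {1,…,N} and all t ≥ 0, the lower bound θ_i'(t) − θ_j'(t) ≥ (θ_i'(0) − θ_j'(0)) e^{−t/m} + (ω_i − ω_j − 2K)(1 − e^{−t/m}) holds. In particular, for N = 4 identical oscillators (ω_i = 0 for all i) with initial velocities θ_2'(0) = −a and θ_3'(0) = a for a > 0, one has θ_3'(t) − θ_2'(t) ≥ 2a e^{−t/m} − 2K for all t ≥ 0. -/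
open Real Filter

/-- Gronwall-type lower bound for the differential inequality `m u' + u ≥ c` on `[0, ∞)`. -/
theorem le_of_le_mul_deriv_add {m c : ℝ} (hm : 0 < m) {u : ℝ → ℝ} (hu : Differentiable ℝ u)
    (h : ∀ t, 0 ≤ t → c ≤ m * deriv u t + u t) {t : ℝ} (ht : 0 ≤ t) :
    u 0 * Real.exp (-t / m) + c * (1 - Real.exp (-t / m)) ≤ u t := by
  have hd : ∀ s, HasDerivAt (fun s => (u s - c) * Real.exp (s / m))
      (deriv u s * Real.exp (s / m) + (u s - c) * (Real.exp (s / m) * (1 / m))) s := fun s =>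
    ((hu s).hasDerivAt.sub_const c).mul ((hasDerivAt_id s).div_const m).exp
  have hmono : MonotoneOn (fun s => (u s - c) * Real.exp (s / m)) (Set.Ici 0) := by
    refine monotoneOn_of_deriv_nonneg (convex_Ici 0)
      (fun s _ => (hd s).continuousAt.continuousWithinAt)
      (fun s _ => (hd s).differentiableAt.differentiableWithinAt) fun s hs => ?_
    rw [interior_Ici, Set.mem_Ioi] at hs
    have hs' : 0 ≤ m * deriv u s + u s - c := sub_nonneg.2 (h s hs.le)
    have key : deriv u s * Real.exp (s / m) + (u s - c) * (Real.exp (s / m) * (1 / m))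
        = (m * deriv u s + u s - c) * Real.exp (s / m) / m := by
      field_simp
      ring
    rw [(hd s).deriv, key]
    positivity
  have h0 : u 0 - c ≤ (u t - c) * Real.exp (t / m) := by
    simpa using hmono Set.self_mem_Ici ht ht
  have h1 := mul_le_mul_of_nonneg_right h0 (Real.exp_pos (-t / m)).le
  rw [mul_assoc, ← Real.exp_add, neg_div, add_neg_cancel, Real.exp_zero] at h1
  rw [neg_div]
  linarith

/-- Each coupling term of the Kuramoto system is bounded by the coupling strength. -/
theorem abs_kuramoto_coupling_le {N : ℕ} {K : ℝ} (hK : 0 ≤ K) (x : Fin N → ℝ) :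
    |K / N * ∑ j, Real.sin (x j)| ≤ K := by
  have hsum : |∑ j, Real.sin (x j)| ≤ N := by
    calc |∑ j, Real.sin (x j)| ≤ ∑ j, |Real.sin (x j)| := Finset.abs_sum_le_sum_abs _ _
      _ ≤ ∑ _j : Fin N, (1 : ℝ) := Finset.sum_le_sum fun j _ => Real.abs_sin_le_one _
      _ = N := by simp
  rw [abs_mul, abs_of_nonneg (by positivity)]
  calc K / N * |∑ j, Real.sin (x j)| ≤ K / N * N := by gcongr
    _ ≤ K := by
      rcases N.eq_zero_or_pos with rfl | hN
      · simpa using hK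
      · exact (div_mul_cancel₀ K (by positivity)).le

/-- Lower bound on velocity differences for a solution of the second-order Kuramoto system. -/
theorem kuramoto_velocity_sub_ge {N : ℕ} {m K : ℝ} (hm : 0 < m) (hK : 0 ≤ K)
    {ω : Fin N → ℝ} {θ : Fin N → ℝ → ℝ} (hsmooth : ∀ i, ContDiff ℝ 2 (θ i))
    (hode : ∀ i, ∀ t : ℝ, 0 ≤ t →
      m * deriv (deriv (θ i)) t + deriv (θ i) t
        = ω i + K / N * ∑ j, Real.sin (θ j t - θ i t))
    (i j : Fin N) {t : ℝ} (ht : 0 ≤ t) :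
    (deriv (θ i) 0 - deriv (θ j) 0) * Real.exp (-t / m)
      + (ω i - ω j - 2 * K) * (1 - Real.exp (-t / m)) ≤ deriv (θ i) t - deriv (θ j) t := by
  have hd : ∀ k, Differentiable ℝ (deriv (θ k)) := fun k =>
    (hsmooth k).differentiable_deriv_two
  refine le_of_le_mul_deriv_add (u := fun s => deriv (θ i) s - deriv (θ j) s) hm
    ((hd i).sub (hd j)) (fun s hs => ?_) ht
  rw [deriv_fun_sub (hd i s) (hd j s)]
  have hi := (abs_le.1 (abs_kuramoto_coupling_le hK fun k => θ k s - θ i s)).1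
  have hj := (abs_le.1 (abs_kuramoto_coupling_le hK fun k => θ k s - θ j s)).2
  linarith [hode i s hs, hode j s hs]

/-- The lower bound on velocity differences for the second-order Kuramoto system:
`θᵢ'(t) - θⱼ'(t) ≥ (θᵢ'(0) - θⱼ'(0)) e^{-t/m} + (ωᵢ - ωⱼ - 2K)(1 - e^{-t/m})`.
In particular, for `N = 4` identical oscillators (`ωᵢ = 0`) with initial
velocities `θ₂'(0) = -a` and `θ₃'(0) = a` (`a > 0`), one has
`θ₃'(t) - θ₂'(t) ≥ 2a e^{-t/m} - 2K` for all `t ≥ 0`. -/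
theorem kuramoto_velocity_difference_lower_bound
    (N : ℕ) (hN : 0 < N) (m K : ℝ) (hm : 0 < m) (hK : 0 < K)
    (ω : Fin N → ℝ) (θ : Fin N → ℝ → ℝ)
    (hsmooth : ∀ i, ContDiff ℝ 2 (θ i))
    (hode : ∀ i, ∀ t : ℝ, 0 ≤ t →
      m * deriv (deriv (θ i)) t + deriv (θ i) t
        = ω i + K / N * ∑ j, Real.sin (θ j t - θ i t)) :
    (∀ i j : Fin N, ∀ t : ℝ, 0 ≤ t →
      deriv (θ i) t - deriv (θ j) t
        ≥ (deriv (θ i) 0 - deriv (θ j) 0) * Real.exp (-t / m)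
          + (ω i - ω j - 2 * K) * (1 - Real.exp (-t / m)))
    ∧ (∀ (φ : Fin 4 → ℝ → ℝ) (a : ℝ), 0 < a →
        (∀ i, ContDiff ℝ 2 (φ i)) →
        (∀ i, ∀ t : ℝ, 0 ≤ t →
          m * deriv (deriv (φ i)) t + deriv (φ i) t
            = K / 4 * ∑ j, Real.sin (φ j t - φ i t)) →
        deriv (φ 1) 0 = -a → deriv (φ 2) 0 = a →
        ∀ t : ℝ, 0 ≤ t →
          deriv (φ 2) t - deriv (φ 1) t ≥ 2 * a * Real.exp (-t / m) - 2 * K) := by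
  refine ⟨fun i j t ht => kuramoto_velocity_sub_ge hm hK.le hsmooth hode i j ht,
    fun φ a _ hφ hφode h1 h2 t ht => ?_⟩
  have h := kuramoto_velocity_sub_ge (ω := fun _ => 0) hm hK.le hφ
    (fun i s hs => by simpa using hφode i s hs) 2 1 ht
  rw [h1, h2] at h
  have := mul_pos hK (Real.exp_pos (-t / m))
  linarith
end
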